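/- arXiv:math/9804131 — 2 statements merged into one kernel-verified Lean document; each statement's English description precedes it below -/
import Mathlib

section
/- If q is not a root of unity, then the centre of the algebra B is exactly the unital ℂ-subalgebra generated by C and C'₂. -/
noncomputable section

namespace SL2q

/-- The free algebra on the four generators X₀, X₊, X₋, C. -/
abbrev Free := FreeAlgebra ℂ (Fin 4)

def gX0 : Free := FreeAlgebra.ι ℂ 0
def gXp : Free := FreeAlgebra.ι ℂ 1
def gXm : Free := FreeAlgebra.ι ℂ 2
def gC  : Free := FreeAlgebra.ι ℂ 3

/-- The defining relations of the algebra B of Lyubashenko–Sudbery. -/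
inductive Rel (q : ℂ) : Free → Free → Prop
  | r1  : Rel q ((q ^ 2) • (gX0 * gXp) - gXp * gX0) (q • (gC * gXp))
  | r2  : Rel q ((q⁻¹ ^ 2) • (gX0 * gXm) - gXm * gX0) (-(q⁻¹ • (gC * gXm)))
  | r3  : Rel q (gXp * gXm - gXm * gXp)
      ((q + q⁻¹) • ((gC - (q - q⁻¹) • gX0) * gX0))
  | rc0 : Rel q (gC * gX0) (gX0 * gC)
  | rcp : Rel q (gC * gXp) (gXp * gC)
  | rcm : Rel q (gC * gXm) (gXm * gC)

/-- The algebra B, presented by generators and relations. -/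
abbrev B (q : ℂ) := RingQuot (Rel q)

def X0 (q : ℂ) : B q := RingQuot.mkAlgHom ℂ (Rel q) gX0
def Xp (q : ℂ) : B q := RingQuot.mkAlgHom ℂ (Rel q) gXp
def Xm (q : ℂ) : B q := RingQuot.mkAlgHom ℂ (Rel q) gXm
def Cc (q : ℂ) : B q := RingQuot.mkAlgHom ℂ (Rel q) gC

/-- C'₂ = X₋X₊ + q⁻¹ C X₀ + q⁻² X₀². -/
def C2 (q : ℂ) : B q :=
  Xm q * Xp q + q⁻¹ • (Cc q * X0 q) + (q⁻¹ ^ 2) • (X0 q) ^ 2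

section Relations

variable (q : ℂ)

/-- The weight element `C - (q - q⁻¹) X₀`, which `q`-commutes with `X₊` and `X₋`. -/
def weight : B q := Cc q - (q - q⁻¹) • X0 q

theorem Cc_mul_X0 : Cc q * X0 q = X0 q * Cc q := by
  simpa [Cc, X0] using RingQuot.mkAlgHom_rel ℂ (Rel.rc0 (q := q))

theorem Cc_mul_Xp : Cc q * Xp q = Xp q * Cc q := by
  simpa [Cc, Xp] using RingQuot.mkAlgHom_rel ℂ (Rel.rcp (q := q))

theorem Cc_mul_Xm : Cc q * Xm q = Xm q * Cc q := by
  simpa [Cc, Xm] using RingQuot.mkAlgHom_rel ℂ (Rel.rcm (q := q))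

theorem Xp_mul_X0 : Xp q * X0 q = q ^ 2 • (X0 q * Xp q) - q • (Cc q * Xp q) := by
  have h : q ^ 2 • (X0 q * Xp q) - Xp q * X0 q = q • (Cc q * Xp q) := by
    simpa [Cc, Xp, X0] using RingQuot.mkAlgHom_rel ℂ (Rel.r1 (q := q))
  rw [← h]; abel

theorem Xm_mul_X0 : Xm q * X0 q = q⁻¹ ^ 2 • (X0 q * Xm q) + q⁻¹ • (Cc q * Xm q) := by
  have h : q⁻¹ ^ 2 • (X0 q * Xm q) - Xm q * X0 q = -(q⁻¹ • (Cc q * Xm q)) := by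
    simpa only [Cc, Xm, X0, map_sub, map_mul, map_smul, map_neg] using
      RingQuot.mkAlgHom_rel ℂ (Rel.r2 (q := q))
  rw [← neg_neg (q⁻¹ • (Cc q * Xm q)), ← h]; abel

theorem Xp_mul_Xm : Xp q * Xm q =
    Xm q * Xp q + (q + q⁻¹) • (Cc q * X0 q - (q - q⁻¹) • (X0 q * X0 q)) := by
  have h : Xp q * Xm q - Xm q * Xp q =
      (q + q⁻¹) • ((Cc q - (q - q⁻¹) • X0 q) * X0 q) := by
    simpa only [Cc, Xp, Xm, X0, map_sub, map_mul, map_smul] using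
      RingQuot.mkAlgHom_rel ℂ (Rel.r3 (q := q))
  rw [sub_mul, smul_mul_assoc] at h
  rw [← h]; abel

theorem induction_generators {motive : B q → Prop}
    (algebraMap : ∀ r, motive (algebraMap ℂ (B q) r))
    (X0 : motive (X0 q)) (Xp : motive (Xp q)) (Xm : motive (Xm q)) (Cc : motive (Cc q))
    (mul : ∀ a b, motive a → motive b → motive (a * b))
    (add : ∀ a b, motive a → motive b → motive (a + b)) (b : B q) : motive b := by
  obtain ⟨a, rfl⟩ := RingQuot.mkAlgHom_surjective ℂ (Rel q) b
  induction a using FreeAlgebra.induction with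
  | grade0 r => simpa using algebraMap r
  | grade1 i =>
    fin_cases i
    exacts [X0, Xp, Xm, Cc]
  | mul a b ha hb => simpa using mul _ _ ha hb
  | add a b ha hb => simpa using add _ _ ha hb

theorem mem_center_of_commute {b : B q} (h0 : Commute b (X0 q)) (hp : Commute b (Xp q))
    (hm : Commute b (Xm q)) (hc : Commute b (Cc q)) : b ∈ Subalgebra.center ℂ (B q) := by
  rw [Subalgebra.mem_center_iff]
  suffices ∀ a, Commute b a from fun a => (this a).symm
  intro a
  induction a using induction_generators with
  | algebraMap r => exact (Algebra.commutes r b).symm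
  | X0 => exact h0
  | Xp => exact hp
  | Xm => exact hm
  | Cc => exact hc
  | mul _ _ h₁ h₂ => exact h₁.mul_right h₂
  | add _ _ h₁ h₂ => exact h₁.add_right h₂

theorem Cc_mem_center : Cc q ∈ Subalgebra.center ℂ (B q) :=
  mem_center_of_commute q (Cc_mul_X0 q) (Cc_mul_Xp q) (Cc_mul_Xm q) (Commute.refl _)

theorem X0_mul_Cc : X0 q * Cc q = Cc q * X0 q := (Cc_mul_X0 q).symm
theorem Xp_mul_Cc : Xp q * Cc q = Cc q * Xp q := (Cc_mul_Xp q).symm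
theorem Xm_mul_Cc : Xm q * Cc q = Cc q * Xm q := (Cc_mul_Xm q).symm

theorem mul_assoc_of_eq {S : Type*} [Semigroup S] {a b c : S} (h : a * b = c) (d : S) :
    a * (b * d) = c * d := by
  rw [← mul_assoc, h]

theorem C2_mem_center (hq : q ≠ 0) : C2 q ∈ Subalgebra.center ℂ (B q) := by
  refine mem_center_of_commute q ?_ ?_ ?_ (Subalgebra.mem_center_iff.1 (Cc_mem_center q) _)
  all_goals
    rw [commute_iff_eq, C2]
    simp only [mul_add, add_mul, mul_sub, sub_mul, smul_mul_assoc, mul_smul_comm, pow_two (X0 q),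
      mul_assoc, Xp_mul_X0, Xm_mul_X0, Xp_mul_Xm,
      mul_assoc_of_eq (Xp_mul_X0 q), mul_assoc_of_eq (Xm_mul_X0 q), mul_assoc_of_eq (Xp_mul_Xm q),
      mul_assoc_of_eq (X0_mul_Cc q), mul_assoc_of_eq (Xp_mul_Cc q), mul_assoc_of_eq (Xm_mul_Cc q)]
    match_scalars <;> field_simp <;> ring_nf

theorem Xp_mul_weight (hq : q ≠ 0) : Xp q * weight q = q ^ 2 • (weight q * Xp q) := by
  simp only [weight, mul_sub, sub_mul, smul_mul_assoc, mul_smul_comm, Xp_mul_X0, Xp_mul_Cc]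
  match_scalars <;> field_simp
  ring

theorem Xm_mul_weight (hq : q ≠ 0) : Xm q * weight q = q⁻¹ ^ 2 • (weight q * Xm q) := by
  simp only [weight, mul_sub, sub_mul, smul_mul_assoc, mul_smul_comm, Xm_mul_X0, Xm_mul_Cc]
  match_scalars <;> field_simp
  ring

end Relations
section Coefficients

open Polynomial

/-- The ring `ℂ[C, Z][w]` of coefficients. -/
abbrev Coeff := Polynomial (MvPolynomial (Fin 2) ℂ)

/-- The variable standing for `C`. -/
def cVar : Coeff := C (MvPolynomial.X 0)

/-- The variable standing for `C'₂`. -/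
def zVar : Coeff := C (MvPolynomial.X 1)

/-- The substitution `w ↦ t w`. -/
def scale (t : ℂ) : Coeff →ₐ[ℂ] Coeff :=
  (aeval (t • (X : Coeff)) : Coeff →ₐ[MvPolynomial (Fin 2) ℂ] Coeff).restrictScalars ℂ

@[simp] theorem scale_C (t : ℂ) (r : MvPolynomial (Fin 2) ℂ) : scale t (C r) = C r := by
  simp [scale]

@[simp] theorem scale_X (t : ℂ) : scale t X = t • (X : Coeff) := by
  simp [scale]

@[simp] theorem scale_cVar (t : ℂ) : scale t cVar = cVar := scale_C t _

@[simp] theorem scale_zVar (t : ℂ) : scale t zVar = zVar := scale_C t _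

theorem coeff_scale (t : ℂ) (f : Coeff) (n : ℕ) : (scale t f).coeff n = t ^ n • f.coeff n := by
  have h : scale t f = f.comp (C (algebraMap ℂ _ t) * X) := by
    simp only [scale, AlgHom.restrictScalars_apply, Algebra.smul_def]
    rfl
  rw [h, comp_C_mul_X_coeff, Algebra.smul_def, map_pow, mul_comm]

theorem scale_one (f : Coeff) : scale 1 f = f := by
  ext1 n; simp [coeff_scale]

theorem scale_mul (s t : ℂ) (f : Coeff) : scale (s * t) f = scale s (scale t f) := by
  ext1 n; simp [coeff_scale, mul_pow, mul_smul]

theorem scale_ne_zero {t : ℂ} (ht : t ≠ 0) {f : Coeff} (hf : f ≠ 0) : scale t f ≠ 0 := by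
  intro h
  apply hf
  rw [← scale_one f, ← inv_mul_cancel₀ ht, scale_mul, h, map_zero]

theorem eq_C_of_scale_eq {t : ℂ} (ht : ∀ n : ℕ, 0 < n → t ^ n ≠ 1) {f : Coeff}
    (hf : scale t f = f) : f = C (f.coeff 0) := by
  ext1 n
  rcases Nat.eq_zero_or_pos n with rfl | hn
  · simp
  · have h := coeff_scale t f n
    rw [hf, eq_comm, ← sub_eq_zero, ← one_smul ℂ (f.coeff n), smul_smul, mul_one, ← sub_smul,
      smul_eq_zero, sub_eq_zero] at h
    rw [coeff_C_of_ne_zero hn.ne']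
    exact h.resolve_left (ht n hn)

variable (q : ℂ)

/-- The polynomial standing for `X₀`. -/
def x0Poly : Coeff := (q - q⁻¹)⁻¹ • (cVar - X)

/-- The polynomial standing for `X₋ X₊`. -/
def xmxpPoly : Coeff := zVar - q⁻¹ • (cVar * x0Poly q) - q⁻¹ ^ 2 • x0Poly q ^ 2

variable {q}

theorem sub_inv_ne_zero (hq : q ≠ 0) (hq2 : q ^ 2 ≠ 1) : q - q⁻¹ ≠ 0 := by
  intro h
  apply hq2
  rw [pow_two]
  nth_rewrite 2 [sub_eq_zero.1 h]
  exact mul_inv_cancel₀ hq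

theorem scale_x0Poly (hq : q ≠ 0) (hq2 : q ^ 2 ≠ 1) :
    scale (q ^ 2) (x0Poly q) = q ^ 2 • x0Poly q - q • cVar := by
  have h := sub_inv_ne_zero hq hq2
  have h' : q ^ 2 - 1 ≠ 0 := sub_ne_zero.2 hq2
  simp only [x0Poly, map_smul, map_sub, scale_cVar, scale_X]
  match_scalars <;> field_simp
  ring

theorem scale_inv_x0Poly (hq : q ≠ 0) (hq2 : q ^ 2 ≠ 1) :
    scale (q⁻¹ ^ 2) (x0Poly q) = q⁻¹ ^ 2 • x0Poly q + q⁻¹ • cVar := by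
  have h := sub_inv_ne_zero hq hq2
  have h' : q ^ 2 - 1 ≠ 0 := sub_ne_zero.2 hq2
  simp only [x0Poly, map_smul, map_sub, scale_cVar, scale_X]
  match_scalars <;> field_simp
  ring

theorem scale_xmxpPoly (hq : q ≠ 0) (hq2 : q ^ 2 ≠ 1) :
    scale (q ^ 2) (xmxpPoly q) = xmxpPoly q +
      (q + q⁻¹) • (cVar * x0Poly q - (q - q⁻¹) • (x0Poly q * x0Poly q)) := by
  simp only [xmxpPoly, map_sub, map_smul, map_mul, scale_cVar, scale_zVar,
    scale_x0Poly hq hq2, mul_sub, sub_mul, mul_smul_comm, smul_mul_assoc,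
    pow_two (x0Poly q), mul_comm (x0Poly q) cVar]
  match_scalars <;> field_simp <;> ring

theorem xmxpPoly_ne_zero : xmxpPoly q ≠ 0 := by
  intro h
  have h' := congrArg (fun f => MvPolynomial.aeval ![(0 : ℂ), 1] (f.coeff 0)) h
  simp [xmxpPoly, x0Poly, cVar, zVar, pow_two, mul_coeff_zero, MvPolynomial.smul_eq_C_mul] at h'

end Coefficients
section NormalForm

open Polynomial

variable {q : ℂ} (hq : q ≠ 0)

/-- The map from polynomials in `C` and `C'₂` to the centre. -/
def toCenter : MvPolynomial (Fin 2) ℂ →ₐ[ℂ] Subalgebra.center ℂ (B q) :=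
  MvPolynomial.aeval ![⟨Cc q, Cc_mem_center q⟩, ⟨C2 q, C2_mem_center q hq⟩]

/-- The evaluation of coefficient polynomials in `B`. -/
def evalCoeff : Coeff →ₐ[ℂ] B q :=
  { eval₂RingHom' ((Subalgebra.center ℂ (B q)).val.comp (toCenter hq)).toRingHom (weight q)
      (fun r => ((Subalgebra.mem_center_iff.1 (toCenter hq r).2) (weight q)).symm) with
    commutes' := fun r => by
      have h : algebraMap ℂ Coeff r = C (algebraMap ℂ _ r) := rfl
      simp [eval₂RingHom', h] }

@[simp] theorem evalCoeff_C (r : MvPolynomial (Fin 2) ℂ) :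
    evalCoeff hq (C r) = toCenter hq r := by
  simp [evalCoeff, eval₂RingHom']

@[simp] theorem evalCoeff_X : evalCoeff hq X = weight q := by
  simp [evalCoeff, eval₂RingHom']

@[simp] theorem evalCoeff_cVar : evalCoeff hq cVar = Cc q := by
  simp [cVar, toCenter]

@[simp] theorem evalCoeff_zVar : evalCoeff hq zVar = C2 q := by
  simp [zVar, toCenter]

theorem toCenter_mem_adjoin (r : MvPolynomial (Fin 2) ℂ) :
    (toCenter hq r : B q) ∈ Algebra.adjoin ℂ {Cc q, C2 q} := by
  induction r using MvPolynomial.induction_on with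
  | C a => simp [toCenter]
  | add p r hp hr => simpa using add_mem hp hr
  | mul_X p i hp =>
    rw [map_mul, Subalgebra.coe_mul]
    refine mul_mem hp (Algebra.subset_adjoin ?_)
    fin_cases i <;> simp [toCenter]

theorem evalCoeff_x0Poly (hq2 : q ^ 2 ≠ 1) : evalCoeff hq (x0Poly q) = X0 q := by
  simp [x0Poly, weight, smul_smul, inv_mul_cancel₀ (sub_inv_ne_zero hq hq2)]

theorem evalCoeff_xmxpPoly (hq2 : q ^ 2 ≠ 1) :
    evalCoeff hq (xmxpPoly q) = Xm q * Xp q := by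
  simp only [xmxpPoly, map_sub, map_smul, map_mul, map_pow, evalCoeff_zVar, evalCoeff_cVar,
    evalCoeff_x0Poly hq hq2, C2]
  abel

theorem evalCoeff_scale_xmxpPoly (hq2 : q ^ 2 ≠ 1) :
    evalCoeff hq (scale (q ^ 2) (xmxpPoly q)) = Xp q * Xm q := by
  rw [scale_xmxpPoly hq hq2, Xp_mul_Xm]
  simp only [map_add, map_sub, map_smul, map_mul, evalCoeff_xmxpPoly hq hq2,
    evalCoeff_x0Poly hq hq2, evalCoeff_cVar]

/-- An element that `t`-commutes with the weight element `scale t`-commutes with all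
coefficients. -/
theorem mul_evalCoeff {b : B q} {t : ℂ} (h : b * weight q = t • (weight q * b)) (f : Coeff) :
    b * evalCoeff hq f = evalCoeff hq (scale t f) * b := by
  induction f using Polynomial.induction_on with
  | C r => simpa using (Subalgebra.mem_center_iff.1 (toCenter hq r).2) b
  | add f g hf hg => simp only [map_add, mul_add, add_mul, hf, hg]
  | monomial n r ih =>
    rw [pow_succ, ← mul_assoc]
    generalize C r * X ^ n = f at ih ⊢
    rw [map_mul, map_mul, map_mul, ← mul_assoc, ih, mul_assoc,
      evalCoeff_X, scale_X, h, map_smul, evalCoeff_X, mul_assoc]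
    simp only [mul_smul_comm, smul_mul_assoc]

theorem Xp_mul_evalCoeff (f : Coeff) :
    Xp q * evalCoeff hq f = evalCoeff hq (scale (q ^ 2) f) * Xp q :=
  mul_evalCoeff hq (Xp_mul_weight q hq) f

theorem Xm_mul_evalCoeff (f : Coeff) :
    Xm q * evalCoeff hq f = evalCoeff hq (scale (q⁻¹ ^ 2) f) * Xm q :=
  mul_evalCoeff hq (Xm_mul_weight q hq) f

variable (q) in
/-- `X₊ ^ n` for `n ≥ 0`, and `X₋ ^ (-n)` for `n < 0`. -/
def ladder : ℤ → B q
  | Int.ofNat n => Xp q ^ n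
  | Int.negSucc n => Xm q ^ (n + 1)

/-- The linear map `∑ fₙ ↦ ∑ fₙ(C, C'₂, w) vₙ`, where `vₙ` is the ladder element of degree `n`. -/
def normalForm : (ℤ →₀ Coeff) →ₗ[ℂ] B q :=
  Finsupp.lsum ℂ fun n => LinearMap.mulRight ℂ (ladder q n) ∘ₗ (evalCoeff hq).toLinearMap

theorem normalForm_single (n : ℤ) (f : Coeff) :
    normalForm hq (Finsupp.single n f) = evalCoeff hq f * ladder q n := by
  simp [normalForm]

theorem evalCoeff_mul_ladder_mem (f : Coeff) (n : ℤ) :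
    evalCoeff hq f * ladder q n ∈ LinearMap.range (normalForm hq) :=
  ⟨_, normalForm_single hq n f⟩

theorem mul_mem_range_normalForm {a : B q}
    (h : ∀ f n, a * (evalCoeff hq f * ladder q n) ∈ LinearMap.range (normalForm hq)) {s : B q}
    (hs : s ∈ LinearMap.range (normalForm hq)) : a * s ∈ LinearMap.range (normalForm hq) := by
  obtain ⟨F, rfl⟩ := hs
  induction F using Finsupp.induction_linear with
  | zero => simp
  | add F G hF hG => rw [map_add, mul_add]; exact add_mem hF hG
  | single n f => rw [normalForm_single]; exact h f n

theorem evalCoeff_mul_mem_range_normalForm (g : Coeff) {s : B q}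
    (hs : s ∈ LinearMap.range (normalForm hq)) :
    evalCoeff hq g * s ∈ LinearMap.range (normalForm hq) := by
  refine mul_mem_range_normalForm hq (fun f n => ?_) hs
  rw [← mul_assoc, ← map_mul]
  exact evalCoeff_mul_ladder_mem hq _ n

theorem normalForm_surjective (hq2 : q ^ 2 ≠ 1) : Function.Surjective (normalForm hq) := by
  suffices h : ∀ b : B q, ∀ s ∈ LinearMap.range (normalForm hq),
      b * s ∈ LinearMap.range (normalForm hq) by
    intro b
    have h1 := h b 1 ⟨Finsupp.single 0 1, by simp [normalForm_single, ladder]⟩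
    rwa [mul_one] at h1
  intro b
  induction b using induction_generators with
  | algebraMap r =>
    intro s hs
    rw [← Algebra.smul_def]
    exact Submodule.smul_mem _ _ hs
  | X0 =>
    intro s hs
    rw [← evalCoeff_x0Poly hq hq2]
    exact evalCoeff_mul_mem_range_normalForm hq _ hs
  | Cc =>
    intro s hs
    rw [← evalCoeff_cVar hq]
    exact evalCoeff_mul_mem_range_normalForm hq _ hs
  | Xp =>
    refine fun s hs => mul_mem_range_normalForm hq (fun f n => ?_) hs
    rw [← mul_assoc, Xp_mul_evalCoeff, mul_assoc]
    apply evalCoeff_mul_mem_range_normalForm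
    rcases n with n | n
    · simpa [ladder, pow_succ'] using evalCoeff_mul_ladder_mem hq 1 (Int.ofNat (n + 1))
    · rw [ladder, pow_succ', ← mul_assoc, ← evalCoeff_scale_xmxpPoly hq hq2]
      rcases n with _ | n
      · simpa [ladder] using evalCoeff_mul_ladder_mem hq (scale (q ^ 2) (xmxpPoly q)) 0
      · exact evalCoeff_mul_ladder_mem hq _ (Int.negSucc n)
  | Xm =>
    refine fun s hs => mul_mem_range_normalForm hq (fun f n => ?_) hs
    rw [← mul_assoc, Xm_mul_evalCoeff, mul_assoc]
    apply evalCoeff_mul_mem_range_normalForm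
    rcases n with n | n
    · rcases n with _ | n
      · simpa [ladder] using evalCoeff_mul_ladder_mem hq 1 (Int.negSucc 0)
      · change Xm q * Xp q ^ (n + 1) ∈ _
        rw [pow_succ', ← mul_assoc, ← evalCoeff_xmxpPoly hq hq2]
        exact evalCoeff_mul_ladder_mem hq _ (Int.ofNat n)
    · simpa [ladder, pow_succ' _ (n + 1)] using
        evalCoeff_mul_ladder_mem hq 1 (Int.negSucc (n + 1))
  | mul a b ha hb =>
    intro s hs
    rw [mul_assoc]
    exact ha _ (hb _ hs)
  | add a b ha hb =>
    intro s hs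
    rw [add_mul]
    exact add_mem (ha _ hs) (hb _ hs)

end NormalForm
section Representation

open Polynomial

variable {q : ℂ} (hq : q ≠ 0) (hq2 : q ^ 2 ≠ 1)

/-- A homomorphic image of the coefficient ring together with an invertible element `up`, with
inverse `down`, that implements the automorphism `w ↦ q² w`. -/
structure SkewData (q : ℂ) (E : Type*) [Ring E] [Algebra ℂ E] where
  /-- The image of the coefficients. -/
  coeff : Coeff →ₐ[ℂ] E
  /-- The element implementing the automorphism. -/
  up : E
  /-- The inverse of `up`. -/
  down : E
  up_mul_coeff (f : Coeff) : up * coeff f = coeff (scale (q ^ 2) f) * up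
  down_mul_coeff (f : Coeff) : down * coeff f = coeff (scale (q⁻¹ ^ 2) f) * down
  up_mul_down : up * down = 1
  down_mul_up : down * up = 1

namespace SkewData

variable {E : Type*} [Ring E] [Algebra ℂ E] (S : SkewData q E)

/-- The images of the generators of `B`. -/
def gen : Fin 4 → E :=
  ![S.coeff (x0Poly q), S.up, S.coeff (xmxpPoly q) * S.down, S.coeff cVar]

theorem coeff_mul_comm (f g : Coeff) : S.coeff f * S.coeff g = S.coeff g * S.coeff f := by
  rw [← map_mul, mul_comm, map_mul]

theorem lift_gX0 : FreeAlgebra.lift ℂ S.gen gX0 = S.coeff (x0Poly q) := by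
  rw [gX0, FreeAlgebra.lift_ι_apply]; rfl

theorem lift_gXp : FreeAlgebra.lift ℂ S.gen gXp = S.up := by
  rw [gXp, FreeAlgebra.lift_ι_apply]; rfl

theorem lift_gXm : FreeAlgebra.lift ℂ S.gen gXm = S.coeff (xmxpPoly q) * S.down := by
  rw [gXm, FreeAlgebra.lift_ι_apply]; rfl

theorem lift_gC : FreeAlgebra.lift ℂ S.gen gC = S.coeff cVar := by
  rw [gC, FreeAlgebra.lift_ι_apply]; rfl

include hq hq2 in
theorem lift_rel ⦃x y : Free⦄ (h : Rel q x y) :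
    FreeAlgebra.lift ℂ S.gen x = FreeAlgebra.lift ℂ S.gen y := by
  induction h <;>
    simp only [map_sub, map_neg, map_smul, map_mul, lift_gX0, lift_gXp, lift_gXm, lift_gC]
  case r1 =>
    simp only [S.up_mul_coeff, scale_x0Poly hq hq2, map_sub, map_smul, sub_mul, smul_mul_assoc]
    abel
  case r2 =>
    rw [mul_assoc _ S.down, S.down_mul_coeff, scale_inv_x0Poly hq hq2,
      ← mul_assoc, ← mul_assoc, ← mul_assoc, ← map_mul, ← map_mul, ← map_mul, mul_add,
      mul_smul_comm, mul_smul_comm, map_add, map_smul, map_smul, add_mul, smul_mul_assoc,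
      smul_mul_assoc, mul_comm (xmxpPoly q), mul_comm (xmxpPoly q)]
    abel
  case r3 =>
    rw [← mul_assoc, S.up_mul_coeff, mul_assoc, S.up_mul_down, mul_assoc,
      S.down_mul_up, mul_one, mul_one, scale_xmxpPoly hq hq2, sub_mul, smul_mul_assoc,
      ← map_mul, ← map_mul]
    simp only [map_add, map_sub, map_smul]
    abel
  case rc0 => exact S.coeff_mul_comm _ _
  case rcp => rw [S.up_mul_coeff, scale_cVar]
  case rcm =>
    rw [mul_assoc _ S.down, S.down_mul_coeff, scale_cVar, ← mul_assoc, ← mul_assoc,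
      S.coeff_mul_comm]

/-- The homomorphism from `B` determined by skew data. -/
def rep : B q →ₐ[ℂ] E :=
  RingQuot.liftAlgHom ℂ ⟨FreeAlgebra.lift ℂ S.gen, S.lift_rel hq hq2⟩

theorem rep_X0 : S.rep hq hq2 (X0 q) = S.coeff (x0Poly q) := by
  rw [rep, X0, RingQuot.liftAlgHom_mkAlgHom_apply, lift_gX0]

theorem rep_Xp : S.rep hq hq2 (Xp q) = S.up := by
  rw [rep, Xp, RingQuot.liftAlgHom_mkAlgHom_apply, lift_gXp]

theorem rep_Xm : S.rep hq hq2 (Xm q) = S.coeff (xmxpPoly q) * S.down := by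
  rw [rep, Xm, RingQuot.liftAlgHom_mkAlgHom_apply, lift_gXm]

theorem rep_Cc : S.rep hq hq2 (Cc q) = S.coeff cVar := by
  rw [rep, Cc, RingQuot.liftAlgHom_mkAlgHom_apply, lift_gC]

theorem rep_C2 : S.rep hq hq2 (C2 q) = S.coeff zVar := by
  have h : zVar = xmxpPoly q + q⁻¹ • (cVar * x0Poly q) + q⁻¹ ^ 2 • x0Poly q ^ 2 := by
    rw [xmxpPoly]; abel
  simp only [h, C2, map_add, map_smul, map_mul, map_pow, rep_Xm, rep_Xp, rep_Cc, rep_X0,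
    mul_assoc, S.down_mul_up, mul_one]

theorem rep_evalCoeff (f : Coeff) : S.rep hq hq2 (evalCoeff hq f) = S.coeff f := by
  have hw : (X : Coeff) = cVar - (q - q⁻¹) • x0Poly q := by
    rw [x0Poly, smul_smul, mul_inv_cancel₀ (sub_inv_ne_zero hq hq2), one_smul, sub_sub_cancel]
  suffices h : (S.rep hq hq2).comp (evalCoeff hq) = S.coeff from DFunLike.congr_fun h f
  apply Polynomial.algHom_ext'
  · apply MvPolynomial.algHom_ext
    intro i
    fin_cases i
    · exact (congrArg (S.rep hq hq2) (evalCoeff_cVar hq)).trans (S.rep_Cc hq hq2)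
    · exact (congrArg (S.rep hq hq2) (evalCoeff_zVar hq)).trans (S.rep_C2 hq hq2)
  · rw [AlgHom.comp_apply, evalCoeff_X, weight, hw]
    simp only [map_sub, map_smul, rep_Cc, rep_X0]

end SkewData

variable (q) in
/-- The diagonal operator with entry `f(C, Z, q⁻²ⁿ w)` at position `n`. -/
def diag : Coeff →ₐ[ℂ] Module.End Coeff (ℤ → Coeff) :=
  ((Algebra.lsmul Coeff Coeff (ℤ → Coeff) : (ℤ → Coeff) →ₐ[Coeff] _).restrictScalars ℂ).comp
    (AlgHom.pi fun n : ℤ => scale ((q ^ 2) ^ (-n)))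

theorem diag_apply (f : Coeff) (m : ℤ → Coeff) (n : ℤ) :
    diag q f m n = scale ((q ^ 2) ^ (-n)) f * m n := rfl

/-- The operator shifting the basis vectors up by one. -/
def shiftUp : Module.End Coeff (ℤ → Coeff) := LinearMap.funLeft Coeff Coeff fun n => n - 1

/-- The operator shifting the basis vectors down by one. -/
def shiftDown : Module.End Coeff (ℤ → Coeff) := LinearMap.funLeft Coeff Coeff fun n => n + 1

theorem shiftUp_apply (m : ℤ → Coeff) (n : ℤ) : shiftUp m n = m (n - 1) := rfl

theorem shiftDown_apply (m : ℤ → Coeff) (n : ℤ) : shiftDown m n = m (n + 1) := rfl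

theorem shiftDown_mul_shiftUp : shiftDown * shiftUp = 1 := by
  ext1 m
  funext n
  simp [shiftDown_apply, shiftUp_apply]

theorem shiftUp_mul_shiftDown : shiftUp * shiftDown = 1 := by
  ext1 m
  funext n
  simp [shiftDown_apply, shiftUp_apply]

include hq in
theorem shiftUp_mul_diag (f : Coeff) :
    shiftUp * diag q f = diag q (scale (q ^ 2) f) * shiftUp := by
  have h0 : q ^ 2 ≠ 0 := pow_ne_zero 2 hq
  ext1 m
  funext n
  simp only [Module.End.mul_apply, shiftUp_apply, diag_apply, ← scale_mul]
  rw [← zpow_add_one₀ h0]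
  congr 4
  ring

include hq in
theorem shiftDown_mul_diag (f : Coeff) :
    shiftDown * diag q f = diag q (scale (q⁻¹ ^ 2) f) * shiftDown := by
  have h0 : q ^ 2 ≠ 0 := pow_ne_zero 2 hq
  ext1 m
  funext n
  simp only [Module.End.mul_apply, shiftDown_apply, diag_apply, ← scale_mul]
  rw [inv_pow, ← zpow_sub_one₀ h0]
  congr 4
  ring

/-- The diagonal and shift operators on sequences of coefficients. -/
def seqData : SkewData q (Module.End Coeff (ℤ → Coeff)) where
  coeff := diag q
  up := shiftUp
  down := shiftDown
  up_mul_coeff := shiftUp_mul_diag hq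
  down_mul_coeff := shiftDown_mul_diag hq
  up_mul_down := shiftUp_mul_shiftDown
  down_mul_up := shiftDown_mul_shiftUp

/-- The generic weight representation of `B`. -/
def seqRep : B q →ₐ[ℂ] Module.End Coeff (ℤ → Coeff) := (seqData hq).rep hq hq2

theorem seqRep_Xp : seqRep hq hq2 (Xp q) = shiftUp := (seqData hq).rep_Xp hq hq2

theorem seqRep_Xm : seqRep hq hq2 (Xm q) = diag q (xmxpPoly q) * shiftDown :=
  (seqData hq).rep_Xm hq hq2

theorem seqRep_evalCoeff (f : Coeff) : seqRep hq hq2 (evalCoeff hq f) = diag q f :=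
  (seqData hq).rep_evalCoeff hq hq2 f

theorem diag_single (f p : Coeff) (n : ℤ) :
    diag q f (Pi.single n p) = Pi.single n (scale ((q ^ 2) ^ (-n)) f * p) := by
  funext k
  rw [diag_apply]
  rcases eq_or_ne k n with rfl | h
  · simp
  · simp [h]

theorem shiftUp_single (p : Coeff) (n : ℤ) :
    shiftUp (Pi.single n p) = Pi.single (n + 1) p := by
  funext k
  simp only [shiftUp_apply, Pi.single_apply, sub_eq_iff_eq_add]

theorem shiftDown_single (p : Coeff) (n : ℤ) :
    shiftDown (Pi.single n p) = Pi.single (n - 1) p := by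
  funext k
  simp only [shiftDown_apply, Pi.single_apply, eq_sub_iff_add_eq]

theorem seqRep_ladder_single (n : ℤ) :
    ∃ p : Coeff, p ≠ 0 ∧ seqRep hq hq2 (ladder q n) (Pi.single 0 1) = Pi.single n p := by
  rcases n with n | n
  · refine ⟨1, one_ne_zero, ?_⟩
    simp only [ladder, map_pow, seqRep_Xp]
    induction n with
    | zero => simp
    | succ n ih => rw [pow_succ', Module.End.mul_apply, ih, shiftUp_single]; rfl
  · simp only [ladder, map_pow, seqRep_Xm]
    have step (k : ℤ) (p : Coeff) (hp : p ≠ 0) : ∃ r : Coeff, r ≠ 0 ∧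
        (diag q (xmxpPoly q) * shiftDown) (Pi.single k p) = Pi.single (k - 1) r := by
      rw [Module.End.mul_apply, shiftDown_single, diag_single]
      exact ⟨_, mul_ne_zero (scale_ne_zero (zpow_ne_zero _ (pow_ne_zero 2 hq))
        xmxpPoly_ne_zero) hp, rfl⟩
    induction n with
    | zero => simpa using step 0 1 one_ne_zero
    | succ n ih =>
      obtain ⟨p, hp, h⟩ := ih
      obtain ⟨r, hr, h'⟩ := step _ p hp
      refine ⟨r, hr, ?_⟩
      rw [pow_succ', Module.End.mul_apply, h, h']
      congr 1

theorem seqRep_normalForm_apply (F : ℤ →₀ Coeff) (n : ℤ) : ∃ p : Coeff, p ≠ 0 ∧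
    seqRep hq hq2 (normalForm hq F) (Pi.single 0 1) n = scale ((q ^ 2) ^ (-n)) (F n) * p := by
  obtain ⟨p, hp, h⟩ := seqRep_ladder_single hq hq2 n
  refine ⟨p, hp, ?_⟩
  induction F using Finsupp.induction_linear with
  | zero => simp
  | add F G hF hG => simp only [map_add, LinearMap.add_apply, Pi.add_apply, hF, hG,
      Finsupp.add_apply, add_mul]
  | single k f =>
    rw [normalForm_single, map_mul, seqRep_evalCoeff, Module.End.mul_apply, diag_apply]
    rcases eq_or_ne k n with rfl | hk
    · simp [h]
    · obtain ⟨r, -, h'⟩ := seqRep_ladder_single hq hq2 k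
      simp [h', hk.symm]

end Representation

/-- if q is not a root of unity, the centre of B is the unital
ℂ-subalgebra generated by C and C'₂. -/
theorem center_generic (q : ℂ) (hq : q ≠ 0) (hq2 : q ^ 2 ≠ 1)
    (hnru : ∀ n : ℕ, 0 < n → q ^ n ≠ 1) :
    Subalgebra.center ℂ (B q) = Algebra.adjoin ℂ {Cc q, C2 q} := by
  have ht : ∀ n : ℕ, 0 < n → (q ^ 2) ^ n ≠ 1 := fun n hn => by
    rw [← pow_mul]; exact hnru _ (by omega)
  have htz : ∀ n : ℤ, n ≠ 0 → (q ^ 2) ^ n ≠ 1 := fun n hn h => by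
    rcases Int.natAbs_eq n with hn' | hn' <;> rw [hn'] at h
    · exact ht _ (Int.natAbs_pos.2 hn) (by simpa only [zpow_natCast] using h)
    · exact ht _ (Int.natAbs_pos.2 hn) (by simpa only [zpow_neg, zpow_natCast, inv_eq_one] using h)
  apply le_antisymm
  · intro b hb
    rw [Subalgebra.mem_center_iff] at hb
    obtain ⟨F, rfl⟩ := normalForm_surjective hq hq2 b
    have hF : F = Finsupp.single 0 (F 0) := by
      ext1 n
      rcases eq_or_ne n 0 with rfl | hn
      · simp
      rw [Finsupp.single_eq_of_ne hn]
      obtain ⟨p, hp, h⟩ := seqRep_normalForm_apply hq hq2 F n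
      have hw := congrArg (fun b => seqRep hq hq2 b (Pi.single 0 1) n)
        (hb (evalCoeff hq Polynomial.X))
      have hsingle : (Pi.single 0 Polynomial.X : ℤ → Coeff) =
          (Polynomial.X : Coeff) • Pi.single 0 1 := by
        rw [← Pi.single_smul, smul_eq_mul, mul_one]
      simp only [map_mul, seqRep_evalCoeff, Module.End.mul_apply, diag_apply, diag_single,
        neg_zero, zpow_zero, scale_X, smul_mul_assoc, one_smul, mul_one, h] at hw
      rw [hsingle, map_smul, Pi.smul_apply, h, smul_eq_mul, ← sub_eq_zero] at hw
      generalize hg : scale ((q ^ 2) ^ (-n)) (F n) * p = g at hw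
      have hw' : ((q ^ 2) ^ (-n) - 1) • (Polynomial.X * g) = 0 := by
        rw [sub_smul, one_smul, hw]
      rw [smul_eq_zero, sub_eq_zero] at hw'
      have hsc := ((mul_eq_zero.1 (hw'.resolve_left (htz _ (neg_ne_zero.2 hn)))).resolve_left
        Polynomial.X_ne_zero)
      by_contra hFn
      exact mul_ne_zero (scale_ne_zero (zpow_ne_zero _ (pow_ne_zero 2 hq)) hFn) hp (hg.trans hsc)
    have hb0 : normalForm hq F = evalCoeff hq (F 0) := by
      rw [hF, normalForm_single]; simp [ladder]
    rw [hb0] at hb ⊢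
    have hs : scale (q ^ 2) (F 0) = F 0 := by
      have hX := congrArg (fun b => seqRep hq hq2 b (Pi.single (-1) 1) 0) (hb (Xp q))
      rw [Xp_mul_evalCoeff] at hX
      simpa [seqRep_evalCoeff, seqRep_Xp, Module.End.mul_apply, shiftUp_single, diag_apply, scale_one]
        using hX
    rw [eq_C_of_scale_eq ht hs, evalCoeff_C]
    exact toCenter_mem_adjoin hq _
  · rw [Algebra.adjoin_le_iff]
    rintro x (rfl | rfl)
    exacts [Cc_mem_center q, C2_mem_center q hq]

end SL2q
end
end

section
/- Assume q^{2l} = 1 where l ≥ 2 is the smallest positive integer with this property. Let (V; ρ₀, ρ₊, ρ₋, ρ_C) be a finite-dimensional irreducible representation of B over ℂ. Then there exist complex scalars c, c'₂, ξ₊, ξ₋, z such that ρ_C = c·id, ρ₋ρ₊ + q⁻¹ρ_Cρ₀ + q⁻²ρ₀² = c'₂·id, ρ₊^l = ξ₊·id, ρ₋^l = ξ₋·id, (ρ_C − λρ₀)^l = z·id, and these scalars satisfy ξ₋·ξ₊ = q^{l(l−1)} λ^{−2l} ( −(d²)^l + q^{−l}·h·z − z² ), where d² := c² − λ²c'₂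 and h := Σ_{j : l−j even} a_j ((q+q⁻¹)c)^j (d²)^{(l−j)/2} with Q_l(x) = Σ_j a_j x^j. -/
noncomputable section

namespace SL2q

section Dickson

/-- The homogenization of a polynomial `Q` with `Q (x + x⁻¹) = x ^ l + x⁻¹ ^ l`. -/
theorem dickson_homogeneous {Q : Polynomial ℂ} {l : ℕ} (hQdeg : Q.natDegree = l)
    (hQ : ∀ x : ℂ, x ≠ 0 → Q.eval (x + x⁻¹) = x ^ l + (x⁻¹) ^ l) (u v : ℂ) :
    ∑ j ∈ Finset.range (l + 1), Q.coeff j * (u ^ 2 + v ^ 2) ^ j * (u * v) ^ (l - j)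
      = u ^ (2 * l) + v ^ (2 * l) := by
  have dense : Dense {x : ℂ | x ≠ 0} := dense_compl_singleton 0
  have off_axes : ∀ u v : ℂ, u ≠ 0 → v ≠ 0 →
      ∑ j ∈ Finset.range (l + 1), Q.coeff j * (u ^ 2 + v ^ 2) ^ j * (u * v) ^ (l - j)
        = u ^ (2 * l) + v ^ (2 * l) := by
    intro u v hu hv
    have h := congrArg ((u * v) ^ l * ·) (hQ (u / v) (div_ne_zero hu hv))
    simp only [Polynomial.eval_eq_sum_range, hQdeg, Finset.mul_sum] at h
    calc _ = ∑ j ∈ Finset.range (l + 1),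
          (u * v) ^ l * (Q.coeff j * (u / v + (u / v)⁻¹) ^ j) := by
          refine Finset.sum_congr rfl fun j hj => ?_
          have hjl : (u * v) ^ (l - j) * (u * v) ^ j = (u * v) ^ l :=
            pow_sub_mul_pow _ (Nat.lt_succ_iff.mp (Finset.mem_range.mp hj))
          have hs : u ^ 2 + v ^ 2 = u * v * (u / v + (u / v)⁻¹) := by
            field_simp
          rw [hs, mul_pow (u * v), ← hjl]
          ring
      _ = _ := by
          rw [h, mul_add, ← mul_pow, ← mul_pow, pow_mul, pow_mul]
          congr 2 <;> field_simp
  have off_axis : ∀ u v : ℂ, u ≠ 0 →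
      ∑ j ∈ Finset.range (l + 1), Q.coeff j * (u ^ 2 + v ^ 2) ^ j * (u * v) ^ (l - j)
        = u ^ (2 * l) + v ^ (2 * l) := fun u v hu =>
    congrFun (Continuous.ext_on dense (by fun_prop) (by fun_prop)
      fun v hv => off_axes u v hu hv :
      (fun v => ∑ j ∈ Finset.range (l + 1),
        Q.coeff j * (u ^ 2 + v ^ 2) ^ j * (u * v) ^ (l - j))
        = fun v => u ^ (2 * l) + v ^ (2 * l)) v
  exact congrFun (Continuous.ext_on dense (by fun_prop) (by fun_prop)
    fun u hu => off_axis u v hu :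
    (fun u => ∑ j ∈ Finset.range (l + 1),
      Q.coeff j * (u ^ 2 + v ^ 2) ^ j * (u * v) ^ (l - j))
      = fun u => u ^ (2 * l) + v ^ (2 * l)) u

theorem dickson_even_homogeneous {Q : Polynomial ℂ} {l : ℕ} (hQdeg : Q.natDegree = l)
    (hQ : ∀ x : ℂ, x ≠ 0 → Q.eval (x + x⁻¹) = x ^ l + (x⁻¹) ^ l) (u v : ℂ) :
    ∑ j ∈ (Finset.range (l + 1)).filter (fun j => Even (l - j)),
      Q.coeff j * (u ^ 2 + v ^ 2) ^ j * ((u * v) ^ 2) ^ ((l - j) / 2)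
      = u ^ (2 * l) + v ^ (2 * l) := by
  have h₁ := dickson_homogeneous hQdeg hQ u v
  have h₂ := dickson_homogeneous hQdeg hQ u (-v)
  rw [(even_two_mul l).neg_pow, neg_sq] at h₂
  have h : (2 : ℂ) * ∑ j ∈ (Finset.range (l + 1)).filter (fun j => Even (l - j)),
      Q.coeff j * (u ^ 2 + v ^ 2) ^ j * ((u * v) ^ 2) ^ ((l - j) / 2)
      = 2 * (u ^ (2 * l) + v ^ (2 * l)) := by
    rw [two_mul (u ^ _ + _)]
    nth_rewrite 1 [← h₁]
    rw [← h₂, ← Finset.sum_add_distrib, Finset.mul_sum, Finset.sum_filter]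
    refine Finset.sum_congr rfl fun j _ => ?_
    rw [mul_neg]
    split_ifs with hj
    · rw [hj.neg_pow, ← pow_mul, Nat.mul_div_cancel' hj.two_dvd]
      ring
    · rw [(Nat.not_even_iff_odd.mp hj).neg_pow]
      ring
  exact mul_left_cancel₀ two_ne_zero h

end Dickson

section QCommutation

variable {A : Type*} [Ring A] [Algebra ℂ A] {a b k : A} {r : ℂ}

theorem mul_pow_of_mul_eq_smul (h : k * b = r • (b * k)) (n : ℕ) :
    k * b ^ n = r ^ n • (b ^ n * k) := by
  induction n with
  | zero => simp
  | succ n ih =>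
    rw [pow_succ, ← mul_assoc, ih, smul_mul_assoc, mul_assoc, h, mul_smul_comm, smul_smul,
      ← mul_assoc, pow_succ]

theorem commute_pow_right_of_mul_eq_smul (h : k * b = r • (b * k)) {n : ℕ} (hr : r ^ n = 1) :
    Commute k (b ^ n) := by
  rw [commute_iff_eq, mul_pow_of_mul_eq_smul h, hr, one_smul]

theorem commute_pow_left_of_mul_eq_smul (h : k * b = r • (b * k)) {n : ℕ} (hr : r ^ n = 1) :
    Commute (k ^ n) b := by
  have h' : MulOpposite.op b * MulOpposite.op k
      = r • (MulOpposite.op k * MulOpposite.op b) := by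
    rw [← MulOpposite.op_mul, h, MulOpposite.op_smul, MulOpposite.op_mul]
  have := commute_pow_right_of_mul_eq_smul h' hr
  rw [← MulOpposite.op_pow] at this
  exact (MulOpposite.commute_op.mp this).symm

/-- If `b * a` is a quadratic polynomial in `k` and `a * b` is the same polynomial in `r * k`,
where `k` and `b` commute up to the scalar `r`, then `a` commutes with the `n`-th power of `b`
as soon as `r ^ n = 1`. -/
theorem commute_pow_of_mul_eq_quadratic {x y w : ℂ} (h : k * b = r • (b * k))
    (hba : b * a = x • 1 + y • k + w • (k * k))
    (hab : a * b = x • 1 + (r * y) • k + (r ^ 2 * w) • (k * k))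
    {n : ℕ} (hn : 0 < n) (hr : r ^ n = 1) : Commute a (b ^ n) := by
  obtain ⟨n, rfl⟩ := Nat.exists_eq_add_one_of_ne_zero hn.ne'
  have hk := mul_pow_of_mul_eq_smul h n
  have hkk : k * k * b ^ n = (r ^ n) ^ 2 • (b ^ n * (k * k)) := by
    rw [mul_assoc, hk, mul_smul_comm, ← mul_assoc, hk, smul_mul_assoc, smul_smul, mul_assoc, sq]
  have hy : r * y * r ^ n = y := by linear_combination y * hr
  have hw : r ^ 2 * w * (r ^ n) ^ 2 = w := by
    linear_combination w * (r ^ (n + 1) + 1) * hr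
  rw [commute_iff_eq, pow_succ, mul_assoc, hba, ← pow_succ, pow_succ', ← mul_assoc, hab]
  simp only [add_mul, mul_add, smul_mul_assoc, mul_smul_comm, hk, hkk, smul_smul, one_mul, mul_one,
    hy, hw]

end QCommutation

section Casimir

variable {A : Type*} [Ring A] [Algebra ℂ A] {e f k : A} {q p s c : ℂ}

theorem casimir_eq (hqp : q * p = 1) (hs : s * (q - p) = 1) :
    f * e + p • (c • (1 : A) * (s • (c • 1 - k)))
        + p ^ 2 • ((s • (c • (1 : A) - k)) * (s • (c • 1 - k)))
      = f * e + s ^ 2 • (c ^ 2 • 1 - ((1 + p ^ 2) * c) • k + p ^ 2 • (k * k)) := by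
  simp only [mul_sub, sub_mul, smul_mul_assoc, mul_smul_comm, one_mul, mul_one]
  match_scalars <;> grind

theorem casimir_commute_weight (hqp : q * p = 1) (hke : k * e = p ^ 2 • (e * k))
    (hkf : k * f = q ^ 2 • (f * k)) :
    Commute (f * e + s ^ 2 • (c ^ 2 • 1 - ((1 + p ^ 2) * c) • k + p ^ 2 • (k * k))) k := by
  have h : k * (f * e) = f * e * k := by
    rw [← mul_assoc, hkf, smul_mul_assoc, mul_assoc, hke, mul_smul_comm, smul_smul, ← mul_pow,
      hqp, one_pow, one_smul, mul_assoc]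
  rw [commute_iff_eq]
  simp only [mul_sub, sub_mul, mul_add, add_mul, smul_mul_assoc, mul_smul_comm, one_mul, mul_one,
    h, mul_assoc]

theorem casimir_commute_raise (hqp : q * p = 1) (hs : s * (q - p) = 1)
    (hke : k * e = p ^ 2 • (e * k))
    (hef : e * f = f * e + (q + p) • (k * (s • (c • 1 - k)))) :
    Commute (f * e + s ^ 2 • (c ^ 2 • 1 - ((1 + p ^ 2) * c) • k + p ^ 2 • (k * k))) e := by
  have h : e * (f * e) = (f * e + (q + p) • (k * (s • (c • 1 - k)))) * e := by
    rw [← mul_assoc, hef]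
  rw [commute_iff_eq]
  simp only [mul_sub, sub_mul, mul_add, add_mul, smul_mul_assoc, mul_smul_comm, one_mul, mul_one,
    h, mul_assoc, hke, smul_smul, smul_sub, smul_add]
  simp only [← mul_assoc, hke, smul_mul_assoc, smul_smul]
  match_scalars <;> grind

theorem casimir_commute_lower (hqp : q * p = 1) (hs : s * (q - p) = 1)
    (hkf : k * f = q ^ 2 • (f * k))
    (hef : e * f = f * e + (q + p) • (k * (s • (c • 1 - k)))) :
    Commute (f * e + s ^ 2 • (c ^ 2 • 1 - ((1 + p ^ 2) * c) • k + p ^ 2 • (k * k))) f := by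
  have h : f * e * f = f * (f * e + (q + p) • (k * (s • (c • 1 - k)))) := by
    rw [mul_assoc, hef]
  rw [commute_iff_eq, add_mul, h]
  simp only [mul_sub, sub_mul, mul_add, add_mul, smul_mul_assoc, mul_smul_comm, one_mul, mul_one,
    mul_assoc, hkf, smul_smul, smul_sub, smul_add]
  simp only [← mul_assoc, hkf, smul_mul_assoc, smul_smul]
  match_scalars <;> grind

end Casimir

section Schur

variable {V : Type*} [AddCommGroup V] [Module ℂ V]

theorem pow_mul_pow_apply_of_quadratic {k a b : Module.End ℂ V} {r x y w μ : ℂ} {v : V}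
    (h : k * a = r • (a * k)) (hba : b * a = x • 1 + y • k + w • (k * k))
    (hv : k v = μ • v) (n : ℕ) :
    (b ^ n * a ^ n) v
      = (∏ i ∈ Finset.range n, (x + y * (r ^ i * μ) + w * (r ^ i * μ) ^ 2)) • v := by
  induction n with
  | zero => simp
  | succ n ih =>
    have hk : k ((a ^ n) v) = (r ^ n * μ) • (a ^ n) v := by
      have := congrArg (· v) (mul_pow_of_mul_eq_smul h n)
      simpa [hv, smul_smul] using this
    have hba' : (b * a) ((a ^ n) v)
        = (x + y * (r ^ n * μ) + w * (r ^ n * μ) ^ 2) • (a ^ n) v := by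
      rw [hba]
      simp only [LinearMap.add_apply, LinearMap.smul_apply, Module.End.mul_apply,
        Module.End.one_apply, hk, map_smul]
      module
    have hsplit : b ^ (n + 1) * a ^ (n + 1) = b ^ n * ((b * a) * a ^ n) := by
      rw [pow_succ, pow_succ' a]
      simp only [mul_assoc]
    rw [hsplit, Module.End.mul_apply, Module.End.mul_apply, hba', map_smul,
      ← Module.End.mul_apply, ih, smul_smul, Finset.prod_range_succ, mul_comm]

/-- Schur's lemma for a family of four operators. -/
theorem exists_eq_smul_one_of_commute [FiniteDimensional ℂ V] [Nontrivial V]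
    {t₁ t₂ t₃ t₄ f : Module.End ℂ V}
    (hirr : ∀ W : Submodule ℂ V, (∀ v ∈ W, t₁ v ∈ W) → (∀ v ∈ W, t₂ v ∈ W) →
      (∀ v ∈ W, t₃ v ∈ W) → (∀ v ∈ W, t₄ v ∈ W) → W = ⊥ ∨ W = ⊤)
    (h₁ : Commute f t₁) (h₂ : Commute f t₂) (h₃ : Commute f t₃) (h₄ : Commute f t₄) :
    ∃ μ : ℂ, f = μ • (1 : Module.End ℂ V) := by
  obtain ⟨μ, hμ⟩ := Module.End.exists_eigenvalue f
  have key : ∀ t : Module.End ℂ V, Commute f t →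
      ∀ v ∈ f.eigenspace μ, t v ∈ f.eigenspace μ := fun t ht v hv =>
    Module.End.mapsTo_genEigenspace_of_comm ht μ 1 hv
  refine ⟨μ, LinearMap.ext fun v => ?_⟩
  have htop := (hirr _ (key _ h₁) (key _ h₂) (key _ h₃) (key _ h₄)).resolve_left hμ
  have hv : v ∈ f.eigenspace μ := htop ▸ Submodule.mem_top
  simpa using Module.End.mem_eigenspace_iff.mp hv

end Schur

section RootsOfUnity

theorem prod_sub_pow_mul {ζ : ℂ} {l : ℕ} (hζ : IsPrimitiveRoot ζ l) (hl : 0 < l) (x a : ℂ) :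
    ∏ i ∈ Finset.range l, (x - ζ ^ i * a) = x ^ l - a ^ l := by
  have := congrArg (Polynomial.eval x) (X_pow_sub_C_eq_prod hζ hl (rfl : a ^ l = a ^ l))
  simpa [Polynomial.eval_prod] using this.symm

theorem isPrimitiveRoot_sq {q : ℂ} {l : ℕ} (hl : 0 < l) (hq2l : q ^ (2 * l) = 1)
    (hmin : ∀ m : ℕ, 0 < m → m < l → q ^ (2 * m) ≠ 1) : IsPrimitiveRoot (q ^ 2) l :=
  IsPrimitiveRoot.mk_of_lt _ hl (by rw [← pow_mul, hq2l])
    fun m h0 hm => by rw [← pow_mul]; exact hmin m h0 hm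

theorem pow_mul_pred_eq_neg_one_pow {q : ℂ} {l : ℕ} (hl : 0 < l)
    (hζ : IsPrimitiveRoot (q ^ 2) l) : q ^ (l * (l - 1)) = (-1) ^ (l - 1) := by
  have hsq : (q ^ l) ^ 2 = 1 := by rw [← pow_mul, mul_comm, pow_mul, hζ.pow_eq_one]
  rw [pow_mul]
  rcases sq_eq_sq_iff_eq_or_eq_neg.mp (hsq.trans (one_pow 2).symm) with h | h
  · have hodd : Odd l := by
      by_contra hne
      obtain ⟨m, rfl⟩ := Nat.not_odd_iff_even.mp hne
      refine hζ.pow_ne_one_of_pos_of_lt (l := m) (by omega) (by omega) ?_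
      rw [← pow_mul, two_mul, h]
    obtain ⟨m, rfl⟩ := hodd
    rw [h, one_pow, Nat.add_sub_cancel, pow_mul, neg_one_sq, one_pow]
  · rw [h]

/-- The product of the values of a quadratic polynomial along an orbit of multiplication by
`q⁻²`. -/
theorem prod_quadratic {q : ℂ} (hq : q ≠ 0) {l : ℕ} (hl : 0 < l)
    (hζ : IsPrimitiveRoot (q ^ 2) l) (a b κ : ℂ) :
    ∏ i ∈ Finset.range l, (-(a * b) + q⁻¹ * (a + b) * ((q⁻¹ ^ 2) ^ i * κ)
        + -(q⁻¹ ^ 2) * ((q⁻¹ ^ 2) ^ i * κ) ^ 2)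
      = q ^ (l * (l - 1)) *
        (-(a * b) ^ l + q⁻¹ ^ l * (a ^ l + b ^ l) * κ ^ l - (κ ^ l) ^ 2) := by
  have hω : (∏ i ∈ Finset.range l, (q⁻¹ ^ 2) ^ i) ^ 2 = 1 := by
    rw [Finset.prod_pow_eq_pow_sum, ← pow_mul, Finset.sum_range_id_mul_two, pow_mul,
      inv_pow, inv_pow, hζ.pow_eq_one, inv_one, one_pow]
  have hfactor : ∀ i, -(a * b) + q⁻¹ * (a + b) * ((q⁻¹ ^ 2) ^ i * κ)
        + -(q⁻¹ ^ 2) * ((q⁻¹ ^ 2) ^ i * κ) ^ 2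
      = -1 * ((q⁻¹ ^ 2) ^ i * (q⁻¹ ^ 2) ^ i) *
        ((q⁻¹ * κ - (q ^ 2) ^ i * a) * (q⁻¹ * κ - (q ^ 2) ^ i * b)) := by
    intro i
    have hi : (q⁻¹ ^ 2) ^ i * (q ^ 2) ^ i = 1 := by
      rw [← mul_pow, ← mul_pow, inv_mul_cancel₀ hq, one_pow, one_pow]
    linear_combination (a * b * ((q⁻¹ ^ 2) ^ i * (q ^ 2) ^ i + 1)
      - q⁻¹ * κ * (q⁻¹ ^ 2) ^ i * (a + b)) * hi
  have hq2l : (q⁻¹ ^ l) ^ 2 = 1 := by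
    rw [← pow_mul, mul_comm l, pow_mul, inv_pow, inv_pow, hζ.pow_eq_one, inv_one]
  have hsign : (-1 : ℂ) ^ l = -(-1) ^ (l - 1) := by
    conv_lhs => rw [← Nat.sub_add_cancel hl, pow_succ, mul_neg_one]
  simp_rw [hfactor]
  rw [Finset.prod_mul_distrib, Finset.prod_mul_distrib, Finset.prod_mul_distrib,
    Finset.prod_mul_distrib, prod_sub_pow_mul hζ hl, prod_sub_pow_mul hζ hl, ← sq, hω,
    Finset.prod_const, Finset.card_range, pow_mul_pred_eq_neg_one_pow hl hζ, hsign]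
  simp only [mul_pow]
  linear_combination (-(-1) ^ (l - 1) * (κ ^ l) ^ 2) * hq2l

end RootsOfUnity

/-- on a finite-dimensional irreducible representation
(V; ρ₀, ρ₊, ρ₋, ρ_C) of B (q a primitive 2l-th root of unity, l ≥ 2), the
central elements C, C'₂, X₊^l, X₋^l, (C−λX₀)^l act by scalars c, c'₂, ξ₊, ξ₋, z
which satisfy ξ₋ξ₊ = q^{l(l−1)} λ^{−2l}( −(d²)^l + q^{−l} h z − z² ), with
d² = c² − λ²c'₂ and h = Σ_{j : l−j even} a_j ((q+q⁻¹)c)^j (d²)^{(l−j)/2},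
where Q_l(x) = Σ_j a_j x^j is the unique polynomial with
Q_l(x+x⁻¹) = x^l + x^{−l}. -/
theorem central_scalars (q : ℂ) (hq : q ≠ 0) (hq2 : q ^ 2 ≠ 1)
    (l : ℕ) (hl : 2 ≤ l) (hq2l : q ^ (2 * l) = 1)
    (hmin : ∀ m : ℕ, 0 < m → m < l → q ^ (2 * m) ≠ 1)
    (Q : Polynomial ℂ) (hQdeg : Q.natDegree = l)
    (hQ : ∀ x : ℂ, x ≠ 0 → Q.eval (x + x⁻¹) = x ^ l + (x⁻¹) ^ l)
    (V : Type) [AddCommGroup V] [Module ℂ V] [FiniteDimensional ℂ V]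
    (ρ0 ρp ρm ρC : Module.End ℂ V)
    (h1 : (q ^ 2 : ℂ) • (ρ0 * ρp) - ρp * ρ0 = q • (ρC * ρp))
    (h2 : (q⁻¹ ^ 2 : ℂ) • (ρ0 * ρm) - ρm * ρ0 = -(q⁻¹ • (ρC * ρm)))
    (h3 : ρp * ρm - ρm * ρp = ((q + q⁻¹) : ℂ) • ((ρC - (q - q⁻¹) • ρ0) * ρ0))
    (hc0 : Commute ρC ρ0) (hcp : Commute ρC ρp) (hcm : Commute ρC ρm)
    (hnt : Nontrivial V)
    (hirr : ∀ W : Submodule ℂ V,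
      (∀ v ∈ W, ρ0 v ∈ W) → (∀ v ∈ W, ρp v ∈ W) →
      (∀ v ∈ W, ρm v ∈ W) → (∀ v ∈ W, ρC v ∈ W) → W = ⊥ ∨ W = ⊤) :
    ∃ c c2 ξp ξm z : ℂ,
      ρC = c • (1 : Module.End ℂ V) ∧
      ρm * ρp + q⁻¹ • (ρC * ρ0) + (q⁻¹ ^ 2 : ℂ) • (ρ0 * ρ0)
        = c2 • (1 : Module.End ℂ V) ∧
      ρp ^ l = ξp • (1 : Module.End ℂ V) ∧
      ρm ^ l = ξm • (1 : Module.End ℂ V) ∧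
      (ρC - (q - q⁻¹) • ρ0) ^ l = z • (1 : Module.End ℂ V) ∧
      ξm * ξp =
        q ^ (l * (l - 1)) * ((q - q⁻¹) ^ (2 * l))⁻¹ *
          ( -((c ^ 2 - (q - q⁻¹) ^ 2 * c2) ^ l)
            + q⁻¹ ^ l *
              (∑ j ∈ (Finset.range (l + 1)).filter (fun j => Even (l - j)),
                Q.coeff j * ((q + q⁻¹) * c) ^ j
                  * (c ^ 2 - (q - q⁻¹) ^ 2 * c2) ^ ((l - j) / 2)) * z
            - z ^ 2 ) := by
  have hl0 : 0 < l := by omega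
  have hζ := isPrimitiveRoot_sq hl0 hq2l hmin
  have hζ' : (q⁻¹ ^ 2) ^ l = 1 := by rw [inv_pow, inv_pow, hζ.pow_eq_one, inv_one]
  have hlam : q - q⁻¹ ≠ 0 := by
    intro h
    apply hq2
    linear_combination q * h + mul_inv_cancel₀ hq
  obtain ⟨c, hC⟩ := exists_eq_smul_one_of_commute hirr hc0 hcp hcm (Commute.refl ρC)
  subst hC
  obtain ⟨K, hK⟩ : ∃ K : Module.End ℂ V, K = c • 1 - (q - q⁻¹) • ρ0 := ⟨_, rfl⟩
  obtain ⟨k, hk⟩ : ∃ k : ℂ, k = (q - q⁻¹)⁻¹ := ⟨_, rfl⟩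
  have hρ0 : ρ0 = k • (c • 1 - K) := by
    rw [hK, hk, sub_sub_cancel, smul_smul, inv_mul_cancel₀ hlam, one_smul]
  have hkl : k * (q - q⁻¹) = 1 := by rw [hk, inv_mul_cancel₀ hlam]
  have hqi : q * q⁻¹ = 1 := mul_inv_cancel₀ hq
  have hKp : K * ρp = (q⁻¹ ^ 2) • (ρp * K) := by
    rw [hρ0] at h1
    simp only [mul_sub, sub_mul, smul_mul_assoc, mul_smul_comm, one_mul, mul_one] at h1
    linear_combination (norm := skip) (-(q - q⁻¹) * q⁻¹ ^ 2) • h1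
    match_scalars <;> grind
  have hKm : K * ρm = (q ^ 2) • (ρm * K) := by
    rw [hρ0] at h2
    simp only [mul_sub, sub_mul, smul_mul_assoc, mul_smul_comm, one_mul, mul_one] at h2
    linear_combination (norm := skip) (-(q - q⁻¹) * q ^ 2) • h2
    match_scalars <;> grind
  have hpm : ρp * ρm = ρm * ρp + (q + q⁻¹) • (K * (k • (c • 1 - K))) := by
    rw [← hρ0, hK, ← h3, add_sub_cancel]
  rw [← hK]
  have of_commute : ∀ f : Module.End ℂ V, Commute f K → Commute f ρp → Commute f ρm →
      ∃ μ : ℂ, f = μ • (1 : Module.End ℂ V) := by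
    intro f hfK hfp hfm
    have hfc : Commute f (c • (1 : Module.End ℂ V)) := (Commute.one_right f).smul_right c
    refine exists_eq_smul_one_of_commute hirr ?_ hfp hfm hfc
    rw [hρ0]
    exact (hfc.sub_right hfK).smul_right k
  have hcas := casimir_eq (f := ρm) (e := ρp) (k := K) (c := c) hqi hkl
  rw [← hρ0] at hcas
  obtain ⟨c2, hc2⟩ := of_commute _ (casimir_commute_weight (s := k) (c := c) hqi hKp hKm)
    (casimir_commute_raise hqi hkl hKp hpm) (casimir_commute_lower hqi hkl hKm hpm)
  obtain ⟨d, hd⟩ : ∃ d, d = c ^ 2 - (q - q⁻¹) ^ 2 * c2 := ⟨_, rfl⟩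
  have hmp : ρm * ρp = (-(k ^ 2 * d)) • 1 + (k ^ 2 * ((1 + q⁻¹ ^ 2) * c)) • K
      + (-(k ^ 2 * q⁻¹ ^ 2)) • (K * K) := by
    rw [hd]
    linear_combination (norm := skip) (1 : ℂ) • hc2
    match_scalars <;> grind
  have hpm' : ρp * ρm = (-(k ^ 2 * d)) • 1 + (q ^ 2 * (k ^ 2 * ((1 + q⁻¹ ^ 2) * c))) • K
      + ((q ^ 2) ^ 2 * (-(k ^ 2 * q⁻¹ ^ 2))) • (K * K) := by
    rw [hpm, hmp]
    simp only [mul_sub, mul_smul_comm, mul_one]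
    match_scalars <;> grind
  have hpP : Commute ρp (ρm ^ l) :=
    commute_pow_of_mul_eq_quadratic hKm hmp hpm' hl0 hζ.pow_eq_one
  have hmP : Commute ρm (ρp ^ l) := by
    refine commute_pow_of_mul_eq_quadratic hKp hpm' ?_ hl0 hζ'
    rw [hmp]
    match_scalars <;> grind
  obtain ⟨ξp, hξp⟩ := of_commute (ρp ^ l) (commute_pow_right_of_mul_eq_smul hKp hζ').symm
    (Commute.pow_self ρp l) hmP.symm
  obtain ⟨ξm, hξm⟩ := of_commute (ρm ^ l)
    (commute_pow_right_of_mul_eq_smul hKm hζ.pow_eq_one).symm hpP.symm (Commute.pow_self ρm l)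
  obtain ⟨z, hz⟩ := of_commute (K ^ l) (Commute.pow_self K l)
    (commute_pow_left_of_mul_eq_smul hKp hζ') (commute_pow_left_of_mul_eq_smul hKm hζ.pow_eq_one)
  refine ⟨c, c2, ξp, ξm, z, rfl, hcas.trans hc2, hξp, hξm, hz, ?_⟩
  obtain ⟨κ, hκ⟩ := Module.End.exists_eigenvalue K
  obtain ⟨v, hv⟩ := hκ.exists_hasEigenvector
  have hzκ : z = κ ^ l := by
    refine smul_left_injective ℂ hv.2 ?_
    have := hv.pow_apply l
    rw [hz] at this
    simpa using this
  have hprod := pow_mul_pow_apply_of_quadratic hKp hmp hv.apply_eq_smul l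
  have hξ : ξm * ξp = ∏ i ∈ Finset.range l, (-(k ^ 2 * d)
      + k ^ 2 * ((1 + q⁻¹ ^ 2) * c) * ((q⁻¹ ^ 2) ^ i * κ)
      + -(k ^ 2 * q⁻¹ ^ 2) * ((q⁻¹ ^ 2) ^ i * κ) ^ 2) := by
    refine smul_left_injective ℂ hv.2 ?_
    rw [hξm, hξp] at hprod
    simpa [smul_smul, mul_comm ξm] using hprod
  obtain ⟨t, ht⟩ := IsAlgClosed.exists_pow_nat_eq (((q + q⁻¹) * c) ^ 2 - 4 * d) two_pos
  obtain ⟨u, hu⟩ := IsAlgClosed.exists_pow_nat_eq (((q + q⁻¹) * c + t) / 2) two_pos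
  obtain ⟨w, hw⟩ := IsAlgClosed.exists_pow_nat_eq (((q + q⁻¹) * c - t) / 2) two_pos
  have hsum : (q + q⁻¹) * c = u ^ 2 + w ^ 2 := by
    linear_combination -hu - hw
  have hmul : d = u ^ 2 * w ^ 2 := by
    rw [hu, hw]
    linear_combination ht / 4
  have hscale : ((q - q⁻¹) ^ (2 * l))⁻¹ = (k ^ 2) ^ l := by
    rw [hk, ← pow_mul, inv_pow]
  have hfactor : ∀ x : ℂ, -(k ^ 2 * d) + k ^ 2 * ((1 + q⁻¹ ^ 2) * c) * x
      + -(k ^ 2 * q⁻¹ ^ 2) * x ^ 2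
      = k ^ 2 * (-(u ^ 2 * w ^ 2) + q⁻¹ * (u ^ 2 + w ^ 2) * x + -(q⁻¹ ^ 2) * x ^ 2) := by
    intro x
    rw [← hsum, ← hmul]
    linear_combination -(k ^ 2 * c * x) * hqi
  have hh := dickson_even_homogeneous hQdeg hQ u w
  rw [← hsum, mul_pow u w, ← hmul, pow_mul u, pow_mul w] at hh
  simp_rw [hfactor] at hξ
  rw [Finset.prod_mul_distrib, Finset.prod_const, Finset.card_range,
    prod_quadratic hq hl0 hζ, ← hmul] at hξ
  rw [← hd, hh, hξ, hzκ, hscale]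
  ring

end SL2q
end
end
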